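/- Let ν be countably subadditive and RL-integrable, let g, h : S → ℝ be measurable, and let p, q ∈ (1,∞) with 1/p + 1/q = 1. If g·h, |g·h|, |g|^p and |h|^q are RL ν-integrable on S, then (RL)∫_S |g·h| dν ≤ ( (RL)∫_S |g|^p dν )^{1/p} · ( (RL)∫_S |h|^q dν )^{1/q} (Hölder inequality). -/

import Mathlib

open Filter Topology

/-- A countable partition of `E` (indexed by `ℕ`): pairwise disjoint measurable sets whose
union is `E`.  Sets are allowed to be empty so that finite partitions are also included;
since `ν ∅ = 0`, empty pieces contribute nothing to the Riemann–Lebesgue sums. -/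
def IsCtblePartition {S : Type*} [MeasurableSpace S] (E : Set S) (A : ℕ → Set S) : Prop :=
  (∀ n, MeasurableSet (A n)) ∧ Pairwise (Function.onFun Disjoint A) ∧ (⋃ n, A n) = E

/-- `P'` is finer than `P`: every set of `P'` is included in some set of `P`. -/
def FinerThan {S : Type*} (P P' : ℕ → Set S) : Prop := ∀ n, ∃ m, P' n ⊆ P m

/-- `t` is a choice of tags for the partition `P` : `t n ∈ P n` whenever `P n ≠ ∅`. -/
def AreTags {S : Type*} (P : ℕ → Set S) (t : ℕ → S) : Prop := ∀ n, (P n).Nonempty → t n ∈ P n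

/-- `h : S → X` is absolutely Riemann–Lebesgue `ν`-integrable on `E` with integral `a`:
for every `ε > 0` there is a countable partition `P₀` of `E` such that for every finer
countable partition `P = {A_n}` of `E`, `h` is bounded on every `A_n` with `ν (A_n) > 0`,
and for every choice of tags `s_n ∈ A_n` the series `Σ_n h (s_n) • ν (A_n)` converges
absolutely with `‖Σ_n h (s_n) • ν (A_n) - a‖ < ε`. -/
def AbsRL {S : Type*} [MeasurableSpace S] {X : Type*} [NormedAddCommGroup X] [NormedSpace ℝ X]
    (ν : Set S → ℝ) (h : S → X) (E : Set S) (a : X) : Prop :=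
  ∀ ε > 0, ∃ P₀ : ℕ → Set S, IsCtblePartition E P₀ ∧
    ∀ P : ℕ → Set S, IsCtblePartition E P → FinerThan P₀ P →
      (∀ n, 0 < ν (P n) → ∃ M, ∀ s ∈ P n, ‖h s‖ ≤ M) ∧
      ∀ t : ℕ → S, AreTags P t →
        Summable (fun n => ‖ν (P n) • h (t n)‖) ∧
        ‖(∑' n, ν (P n) • h (t n)) - a‖ < ε

/-- `h : S → X` is (unconditionally) Riemann–Lebesgue `ν`-integrable on `E` with integral `a`:
as `AbsRL`, but the series is only required to converge unconditionally. -/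
def RL {S : Type*} [MeasurableSpace S] {X : Type*} [NormedAddCommGroup X] [NormedSpace ℝ X]
    (ν : Set S → ℝ) (h : S → X) (E : Set S) (a : X) : Prop :=
  ∀ ε > 0, ∃ P₀ : ℕ → Set S, IsCtblePartition E P₀ ∧
    ∀ P : ℕ → Set S, IsCtblePartition E P → FinerThan P₀ P →
      (∀ n, 0 < ν (P n) → ∃ M, ∀ s ∈ P n, ‖h s‖ ≤ M) ∧
      ∀ t : ℕ → S, AreTags P t →
        Summable (fun n => ν (P n) • h (t n)) ∧
        ‖(∑' n, ν (P n) • h (t n)) - a‖ < ε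

/-- `h` is Birkhoff simple `ν`-integrable on `E` with integral `b`. -/
def BirkhoffSimple {S : Type*} [MeasurableSpace S] {X : Type*} [NormedAddCommGroup X]
    [NormedSpace ℝ X] (ν : Set S → ℝ) (h : S → X) (E : Set S) (b : X) : Prop :=
  ∀ ε > 0, ∃ P₀ : ℕ → Set S, IsCtblePartition E P₀ ∧
    ∀ P : ℕ → Set S, IsCtblePartition E P → FinerThan P₀ P →
      ∀ t : ℕ → S, AreTags P t →
        Filter.limsup (fun n => ‖(∑ k ∈ Finset.range (n + 1), ν (P k) • h (t k)) - b‖)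
          Filter.atTop < ε

/-- The set of all finite sums `Σ_i ν (A_i)` over finite pairwise disjoint families of
measurable sets contained in `E`. -/
def variationSet {S : Type*} [MeasurableSpace S] (ν : Set S → ℝ) (E : Set S) : Set ℝ :=
  { x | ∃ (k : ℕ) (A : Fin k → Set S), (∀ i, MeasurableSet (A i)) ∧ (∀ i, A i ⊆ E) ∧
        Pairwise (Function.onFun Disjoint A) ∧ x = ∑ i, ν (A i) }

/-- The variation `ν̄ (E)` of a set function `ν`. -/
noncomputable def variation {S : Type*} [MeasurableSpace S] (ν : Set S → ℝ) (E : Set S) : ℝ :=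
  sSup (variationSet ν E)

/-- `ν` is of finite variation (on `S`). -/
def FiniteVariation {S : Type*} [MeasurableSpace S] (ν : Set S → ℝ) : Prop :=
  BddAbove (variationSet ν Set.univ)

/-- The semivariation `ν̃ (A) = inf { ν̄ (B) : A ⊆ B, B measurable }`. -/
noncomputable def semivariation {S : Type*} [MeasurableSpace S] (ν : Set S → ℝ)
    (A : Set S) : ℝ :=
  sInf { x | ∃ B : Set S, MeasurableSet B ∧ A ⊆ B ∧ x = variation ν B }

/-- A finite partition of `E`, indexed by `Fin k` (pieces may be empty). -/
def IsFinPartition {S : Type*} [MeasurableSpace S] (E : Set S) {k : ℕ}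
    (A : Fin k → Set S) : Prop :=
  (∀ i, MeasurableSet (A i)) ∧ Pairwise (Function.onFun Disjoint A) ∧ (⋃ i, A i) = E

/-- `h` is Gould `ν`-integrable on `E` with integral `a`. -/
def Gould {S : Type*} [MeasurableSpace S] (ν : Set S → ℝ) (h : S → ℝ) (E : Set S)
    (a : ℝ) : Prop :=
  ∀ ε > 0, ∃ (k : ℕ) (P₀ : Fin k → Set S), IsFinPartition E P₀ ∧
    ∀ (l : ℕ) (P : Fin l → Set S), IsFinPartition E P → (∀ j, ∃ i, P j ⊆ P₀ i) →
      ∀ t : Fin l → S, (∀ j, (P j).Nonempty → t j ∈ P j) →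
        |(∑ j, ν (P j) * h (t j)) - a| < ε

/-- Condition (E) for a set function `μ` (defined at least on the measurable sets). -/
def ConditionE {S : Type*} [MeasurableSpace S] (μ : Set S → ℝ) : Prop :=
  ∀ B : ℕ → ℕ → Set S, (∀ m n, MeasurableSet (B m n)) →
    (∀ m, Antitone fun n => B m n) →
    μ (⋃ m, ⋂ n, B m n) = 0 →
    ∃ np mp : ℕ → ℕ, StrictMono np ∧ StrictMono mp ∧
      Filter.Tendsto (fun k => μ (⋃ p, ⋃ (_ : k ≤ p), B (mp p) (np p)))
        Filter.atTop (nhds 0)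

theorem IsCtblePartition.exists_common_refinement {S : Type*} [MeasurableSpace S] {E : Set S}
    {A B : ℕ → Set S} (hA : IsCtblePartition E A) (hB : IsCtblePartition E B) :
    ∃ C : ℕ → Set S, IsCtblePartition E C ∧ FinerThan A C ∧ FinerThan B C := by
  refine ⟨fun n => A n.unpair.1 ∩ B n.unpair.2, ⟨fun n => (hA.1 _).inter (hB.1 _), ?_, ?_⟩,
    fun n => ⟨_, Set.inter_subset_left⟩, fun n => ⟨_, Set.inter_subset_right⟩⟩
  · intro m n hmn
    have hne : m.unpair.1 ≠ n.unpair.1 ∨ m.unpair.2 ≠ n.unpair.2 := by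
      by_contra! hc
      exact hmn (by rw [← Nat.pair_unpair m, ← Nat.pair_unpair n, hc.1, hc.2])
    rcases hne with hne | hne
    · exact (hA.2.1 hne).mono Set.inter_subset_left Set.inter_subset_left
    · exact (hB.2.1 hne).mono Set.inter_subset_right Set.inter_subset_right
  · ext x
    simp only [Set.mem_iUnion, Set.mem_inter_iff]
    constructor
    · rintro ⟨n, hx, -⟩
      exact hA.2.2 ▸ Set.mem_iUnion.2 ⟨_, hx⟩
    · intro hx
      obtain ⟨i, hi⟩ := Set.mem_iUnion.1 (hA.2.2.symm ▸ hx)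
      obtain ⟨j, hj⟩ := Set.mem_iUnion.1 (hB.2.2.symm ▸ hx)
      exact ⟨Nat.pair i j, by simpa using ⟨hi, hj⟩⟩

theorem FinerThan.trans {S : Type*} {A B C : ℕ → Set S} (hAB : FinerThan A B)
    (hBC : FinerThan B C) : FinerThan A C := fun n =>
  have ⟨m, hm⟩ := hBC n
  have ⟨k, hk⟩ := hAB m
  ⟨k, hm.trans hk⟩

theorem exists_areTags {S : Type*} [Nonempty S] (P : ℕ → Set S) : ∃ t : ℕ → S, AreTags P t := by
  have hex : ∀ n, ∃ s, (P n).Nonempty → s ∈ P n := fun n => by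
    by_cases hn : (P n).Nonempty
    · exact ⟨hn.some, fun _ => hn.some_mem⟩
    · exact ⟨Classical.arbitrary S, fun hc => absurd hc hn⟩
  exact ⟨fun n => (hex n).choose, fun n => (hex n).choose_spec⟩

/-- Three absolutely Riemann–Lebesgue integrable functions have Riemann–Lebesgue sums over one
tagged partition that approximate all three integrals simultaneously. -/
theorem AbsRL.exists_common_approx {S : Type*} [Nonempty S] [MeasurableSpace S] {ν : Set S → ℝ}
    {f₁ f₂ f₃ : S → ℝ} {E : Set S} {a₁ a₂ a₃ : ℝ} (h₁ : AbsRL ν f₁ E a₁) (h₂ : AbsRL ν f₂ E a₂)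
    (h₃ : AbsRL ν f₃ E a₃) {ε : ℝ} (hε : 0 < ε) :
    ∃ (P : ℕ → Set S) (t : ℕ → S), IsCtblePartition E P ∧
      |(∑' n, ν (P n) * f₁ (t n)) - a₁| < ε ∧
      (Summable (fun n => ν (P n) * f₂ (t n)) ∧ |(∑' n, ν (P n) * f₂ (t n)) - a₂| < ε) ∧
      (Summable (fun n => ν (P n) * f₃ (t n)) ∧ |(∑' n, ν (P n) * f₃ (t n)) - a₃| < ε) := by
  obtain ⟨P₁, hP₁, H₁⟩ := h₁ ε hε
  obtain ⟨P₂, hP₂, H₂⟩ := h₂ ε hε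
  obtain ⟨P₃, hP₃, H₃⟩ := h₃ ε hε
  obtain ⟨Q, hQ, hQ₁, hQ₂⟩ := hP₁.exists_common_refinement hP₂
  obtain ⟨P, hP, hPQ, hPP₃⟩ := hQ.exists_common_refinement hP₃
  obtain ⟨t, ht⟩ := exists_areTags P
  have k₁ := (H₁ P hP (hQ₁.trans hPQ)).2 t ht
  have k₂ := (H₂ P hP (hQ₂.trans hPQ)).2 t ht
  have k₃ := (H₃ P hP hPP₃).2 t ht
  exact ⟨P, t, hP, k₁.2, ⟨k₂.1.of_norm, k₂.2⟩, ⟨k₃.1.of_norm, k₃.2⟩⟩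

theorem tsum_weight_mul_le_Lp_mul_Lq {ι : Type*} {p q : ℝ} (hpq : p.HolderConjugate q)
    {w x y : ι → ℝ} (hw : ∀ i, 0 ≤ w i)
    (hx : Summable fun i => w i * |x i| ^ p) (hy : Summable fun i => w i * |y i| ^ q) :
    ∑' i, w i * |x i * y i| ≤
      (∑' i, w i * |x i| ^ p) ^ (1 / p) * (∑' i, w i * |y i| ^ q) ^ (1 / q) := by
  have hpow : ∀ {r : ℝ}, r ≠ 0 → ∀ (z : ι → ℝ) i,
      (w i ^ (1 / r) * |z i|) ^ r = w i * |z i| ^ r := fun {r} hr z i => by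
    rw [Real.mul_rpow (Real.rpow_nonneg (hw i) _) (abs_nonneg _), ← Real.rpow_mul (hw i),
      one_div_mul_cancel hr, Real.rpow_one]
  have hmul : ∀ i, w i ^ (1 / p) * |x i| * (w i ^ (1 / q) * |y i|) = w i * |x i * y i| :=
    fun i => by
      have hwi : w i ^ (1 / p) * w i ^ (1 / q) = w i := by
        rw [← Real.rpow_add_of_nonneg (hw i) hpq.one_div_nonneg hpq.symm.one_div_nonneg,
          one_div, one_div, hpq.inv_add_inv_eq_one, Real.rpow_one]
      rw [mul_mul_mul_comm, hwi, abs_mul]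
  have key := Real.inner_le_Lp_mul_Lq_tsum_of_nonneg hpq
    (f := fun i => w i ^ (1 / p) * |x i|) (g := fun i => w i ^ (1 / q) * |y i|)
    (fun i => mul_nonneg (Real.rpow_nonneg (hw i) _) (abs_nonneg _))
    (fun i => mul_nonneg (Real.rpow_nonneg (hw i) _) (abs_nonneg _))
    (by simpa only [hpow hpq.ne_zero] using hx)
    (by simpa only [hpow hpq.symm.ne_zero] using hy)
  simpa only [hpow hpq.ne_zero, hpow hpq.symm.ne_zero, hmul] using key

/-- Hölder inequality for the Riemann–Lebesgue integral with respect to a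
countably subadditive, RL-integrable set function. -/
theorem absRL_holder
    {S : Type*} [Nonempty S] [MeasurableSpace S]
    (ν : Set S → ℝ) (hν0 : ν ∅ = 0) (hνnn : ∀ A : Set S, MeasurableSet A → 0 ≤ ν A)
    (hσsub : ∀ (A : Set S) (B : ℕ → Set S), MeasurableSet A →
      (∀ n, MeasurableSet (B n)) → A = ⋃ n, B n →
      ENNReal.ofReal (ν A) ≤ ∑' n, ENNReal.ofReal (ν (B n)))
    (hRLint : ∀ E : Set S, MeasurableSet E →
      AbsRL ν (E.indicator fun _ => (1 : ℝ)) Set.univ (ν E))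
    (g h : S → ℝ) (hg : Measurable g) (hh : Measurable h)
    (p q : ℝ) (hp : 1 < p) (hq : 1 < q) (hpq : 1 / p + 1 / q = 1)
    (I₀ Igh Ig Ih : ℝ)
    (h₀ : AbsRL ν (fun s => g s * h s) Set.univ I₀)
    (h₁ : AbsRL ν (fun s => |g s * h s|) Set.univ Igh)
    (h₂ : AbsRL ν (fun s => |g s| ^ p) Set.univ Ig)
    (h₃ : AbsRL ν (fun s => |h s| ^ q) Set.univ Ih) :
    Igh ≤ Ig ^ (1 / p) * Ih ^ (1 / q) := by
  have hconj : p.HolderConjugate q :=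
    Real.holderConjugate_iff.2 ⟨hp, by simpa only [one_div] using hpq⟩
  have hlim : Tendsto (fun n : ℕ => 1 / ((n : ℝ) + 1)) atTop (𝓝 0) :=
    tendsto_one_div_add_atTop_nhds_zero_nat
  choose P t hP happrox hg_approx hh_approx using fun n : ℕ =>
    h₁.exists_common_approx h₂ h₃ (ε := 1 / ((n : ℝ) + 1)) Nat.one_div_pos_of_nat
  have tendsto_of_close : ∀ {u : ℕ → ℝ} {a : ℝ}, (∀ n : ℕ, |u n - a| < 1 / ((n : ℝ) + 1)) →
      Tendsto u atTop (𝓝 a) := fun hu => tendsto_iff_dist_tendsto_zero.2 <|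
    squeeze_zero (fun _ => dist_nonneg) (fun n => (hu n).le) hlim
  exact le_of_tendsto_of_tendsto' (tendsto_of_close happrox)
    (((tendsto_of_close fun n => (hg_approx n).2).rpow_const (Or.inr hconj.one_div_nonneg)).mul
      ((tendsto_of_close fun n => (hh_approx n).2).rpow_const
        (Or.inr hconj.symm.one_div_nonneg)))
    (fun n => tsum_weight_mul_le_Lp_mul_Lq hconj (fun i => hνnn _ ((hP n).1 i))
      (hg_approx n).1 (hh_approx n).1)
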